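/- For n ≥ 1 and n' ≥ 0 with n ≠ n', the vectorial spherical harmonic 𝒩ₙᵐ(x̂) = −∇_S Y_{n−1}ᵐ(x̂) + n Y_{n−1}ᵐ(x̂) x̂ satisfies ∫_{𝕊²} 𝒩ₙᵐ(x̂) Y_{n'}^{m'}(x̂) ds = 0 (the integral of the ℂ³-valued function against the scalar spherical harmonic vanishes componentwise). -/

import Mathlib

open Real MeasureTheory

local notation "E3" => EuclideanSpace ℝ (Fin 3)


noncomputable def Gamma0 (x : E3) : ℝ := -1 / (4 * Real.pi * ‖x‖)

/-- Partial derivative of a ℂ-valued function in the `i`-th direction. -/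
noncomputable def pdC (f : E3 → ℂ) (i : Fin 3) (x : E3) : ℂ :=
  fderiv ℝ f x (EuclideanSpace.single i 1)

/-- The (componentwise) Laplacian of a ℂ-valued function. -/
noncomputable def lapC (f : E3 → ℂ) (x : E3) : ℂ := ∑ i : Fin 3, pdC (pdC f i) i x

/-- Radial projection `x ↦ x/‖x‖`. -/
noncomputable def unitize (x : E3) : E3 := ‖x‖⁻¹ • x

/-- Surface gradient on `𝕊²`: gradient of the degree-0 homogeneous extension. -/
noncomputable def surfGrad (f : E3 → ℂ) (x : E3) (i : Fin 3) : ℂ :=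
  fderiv ℝ (fun y => f (unitize y)) x (EuclideanSpace.single i 1)

/-- Surface measure on the unit sphere. -/
noncomputable def sphereMeasure : Measure (Metric.sphere (0 : E3) 1) :=
  (volume : Measure E3).toSphere

/-- The vectorial spherical harmonic
`𝒩ₙᵐ(x̂) = −∇_S Y_{n−1}ᵐ(x̂) + n Y_{n−1}ᵐ(x̂) x̂` (as a `ℂ³`-valued function). -/
noncomputable def Nvec (Y : ℕ → ℤ → E3 → ℂ) (n : ℕ) (m : ℤ) (x : E3) (i : Fin 3) : ℂ :=
  -surfGrad (Y (n - 1) m) x i + (n : ℂ) * Y (n - 1) m x * ((x i : ℝ) : ℂ)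

open Filter Topology

/-- Smoothness on the complement of the origin. -/
def SmoothAwayFromZero (f : E3 → ℂ) : Prop :=
  ∀ x : E3, x ≠ 0 → ContDiffAt ℝ (⊤ : ℕ∞) f x

/-- Positive homogeneity of integer degree. -/
def PosHomogeneous (a : ℤ) (f : E3 → ℂ) : Prop :=
  ∀ t : ℝ, 0 < t → ∀ x : E3, f (t • x) = (t : ℂ) ^ a * f x

/-- The radial function `x ↦ ‖x‖ ^ a`. -/
noncomputable def radialPow (a : ℤ) (x : E3) : ℂ := (‖x‖ : ℂ) ^ a

section PartialDerivatives

variable {f g : E3 → ℂ} {x : E3}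

theorem SmoothAwayFromZero.differentiableAt (hf : SmoothAwayFromZero f) (hx : x ≠ 0) :
    DifferentiableAt ℝ f x :=
  (hf x hx).differentiableAt (by simp)

theorem SmoothAwayFromZero.mul (hf : SmoothAwayFromZero f) (hg : SmoothAwayFromZero g) :
    SmoothAwayFromZero (fun y => f y * g y) :=
  fun x hx => (hf x hx).mul (hg x hx)

theorem ContDiffAt.pdC (hf : ContDiffAt ℝ (⊤ : ℕ∞) f x) (i : Fin 3) :
    ContDiffAt ℝ (⊤ : ℕ∞) (pdC f i) x :=
  (hf.fderiv_right (m := (⊤ : ℕ∞)) (by simp)).clm_apply contDiffAt_const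

theorem SmoothAwayFromZero.pdC (hf : SmoothAwayFromZero f) (i : Fin 3) :
    SmoothAwayFromZero (pdC f i) :=
  fun x hx => (hf x hx).pdC i

theorem pdC_congr (h : f =ᶠ[𝓝 x] g) (i : Fin 3) : pdC f i =ᶠ[𝓝 x] pdC g i :=
  h.fderiv.fun_comp (fun L => L (EuclideanSpace.single i 1))

theorem lapC_congr (h : f =ᶠ[𝓝 x] g) : lapC f =ᶠ[𝓝 x] lapC g := by
  have := fun i => pdC_congr (pdC_congr h i) i
  filter_upwards [eventually_all.2 this] with y hy
  simp [lapC, hy]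

theorem pdC_mul (hf : DifferentiableAt ℝ f x) (hg : DifferentiableAt ℝ g x) (i : Fin 3) :
    pdC (fun y => f y * g y) i x = f x * pdC g i x + pdC f i x * g x := by
  simp [pdC, fderiv_fun_mul hf hg, mul_comm (g x)]

theorem pdC_add (hf : DifferentiableAt ℝ f x) (hg : DifferentiableAt ℝ g x) (i : Fin 3) :
    pdC (fun y => f y + g y) i x = pdC f i x + pdC g i x := by
  simp [pdC, fderiv_fun_add hf hg]

theorem pdC_sub (hf : DifferentiableAt ℝ f x) (hg : DifferentiableAt ℝ g x) (i : Fin 3) :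
    pdC (fun y => f y - g y) i x = pdC f i x - pdC g i x := by
  simp [pdC, fderiv_fun_sub hf hg]

theorem sum_coord_smul_single (x : E3) :
    ∑ i : Fin 3, x i • (EuclideanSpace.single i 1 : E3) = x := by
  ext j
  fin_cases j <;> simp [Fin.sum_univ_three]

theorem sum_coord_mul_pdC (f : E3 → ℂ) (x : E3) :
    ∑ i : Fin 3, ((x i : ℝ) : ℂ) * pdC f i x = fderiv ℝ f x x := by
  conv_rhs => rw [← sum_coord_smul_single x, map_sum]
  rw [sum_coord_smul_single]
  simp [pdC]

theorem eventually_ne_zero (hx : x ≠ 0) : ∀ᶠ y in 𝓝 x, y ≠ 0 :=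
  isOpen_ne.mem_nhds hx

theorem lapC_mul (hf : SmoothAwayFromZero f) (hg : SmoothAwayFromZero g) (hx : x ≠ 0) :
    lapC (fun y => f y * g y) x =
      f x * lapC g x + 2 * ∑ i : Fin 3, pdC f i x * pdC g i x + lapC f x * g x := by
  have key : ∀ i : Fin 3, pdC (pdC (fun y => f y * g y) i) i x =
      f x * pdC (pdC g i) i x + 2 * (pdC f i x * pdC g i x) + pdC (pdC f i) i x * g x := by
    intro i
    have h : pdC (fun y => f y * g y) i =ᶠ[𝓝 x] fun y => f y * pdC g i y + pdC f i y * g y := by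
      filter_upwards [eventually_ne_zero hx] with y hy
      exact pdC_mul (hf.differentiableAt hy) (hg.differentiableAt hy) i
    rw [(pdC_congr h i).self_of_nhds,
      pdC_add ((hf.mul (hg.pdC i)).differentiableAt hx) (((hf.pdC i).mul hg).differentiableAt hx),
      pdC_mul (hf.differentiableAt hx) ((hg.pdC i).differentiableAt hx),
      pdC_mul ((hf.pdC i).differentiableAt hx) (hg.differentiableAt hx)]
    ring
  simp only [lapC, key, Finset.sum_add_distrib, Finset.mul_sum, Finset.sum_mul]

theorem pdC_comm (hf : ContDiffAt ℝ (⊤ : ℕ∞) f x) (i j : Fin 3) :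
    pdC (pdC f i) j x = pdC (pdC f j) i x := by
  have hd : DifferentiableAt ℝ (fderiv ℝ f) x :=
    (hf.fderiv_right (m := (⊤ : ℕ∞)) (by simp)).differentiableAt (by simp)
  have key : ∀ i j : Fin 3, pdC (pdC f i) j x =
      fderiv ℝ (fderiv ℝ f) x (EuclideanSpace.single j 1) (EuclideanSpace.single i 1) := by
    intro i j
    unfold pdC
    rw [fderiv_clm_apply hd (differentiableAt_const _)]
    simp
  rw [key, key]
  exact (hf.isSymmSndFDerivAt (by simpa using WithTop.coe_le_coe.2 (le_top (a := (2 : ℕ∞))))).eq _ _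

theorem lapC_pdC (hf : SmoothAwayFromZero f) (hx : x ≠ 0) (i : Fin 3) :
    lapC (pdC f i) x = pdC (lapC f) i x := by
  have hsum : pdC (lapC f) i x = ∑ j : Fin 3, pdC (pdC (pdC f j) j) i x := by
    unfold lapC
    rw [pdC, fderiv_fun_sum fun j _ => ((hf.pdC j).pdC j).differentiableAt hx]
    simp [pdC]
  rw [hsum]
  refine Finset.sum_congr rfl fun j _ => ?_
  have h : pdC (pdC f i) j =ᶠ[𝓝 x] pdC (pdC f j) i := by
    filter_upwards [eventually_ne_zero hx] with y hy
    exact pdC_comm (hf y hy) i j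
  rw [(pdC_congr h j).self_of_nhds]
  exact pdC_comm ((hf.pdC j) x hx) i j

end PartialDerivatives

section Homogeneity

variable {f g : E3 → ℂ} {x : E3} {a : ℤ}

theorem PosHomogeneous.pdC (hf : PosHomogeneous a f) (i : Fin 3) :
    PosHomogeneous (a - 1) (pdC f i) := by
  intro t ht x
  have h : fderiv ℝ (fun y => f (t • y)) x = t • fderiv ℝ f (t • x) := fderiv_comp_smul t
  rw [funext (hf t ht)] at h
  have h' := congrArg (fun L => L (EuclideanSpace.single i 1)) h
  have htc : (t : ℂ) ≠ 0 := by exact_mod_cast ht.ne'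
  have hc : fderiv ℝ (fun y => (t : ℂ) ^ a * f y) x = (t : ℂ) ^ a • fderiv ℝ f x :=
    congrFun (fderiv_const_smul_field (f := f) (R := ℂ) ((t : ℂ) ^ a)) x
  rw [hc] at h'
  simp only [smul_apply, smul_eq_mul, Complex.real_smul] at h'
  rw [zpow_sub_one₀ htc]
  change _ = _ * fderiv ℝ f x _
  unfold _root_.pdC
  field_simp
  linear_combination -h'

theorem PosHomogeneous.sum_coord_mul_pdC_eq_zero (hf : PosHomogeneous 0 f)
    (hs : SmoothAwayFromZero f) (hx : x ≠ 0) :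
    ∑ i : Fin 3, ((x i : ℝ) : ℂ) * _root_.pdC f i x = 0 := by
  rw [sum_coord_mul_pdC]
  have h1 : HasDerivAt (fun t : ℝ => t • x) x 1 := by
    simpa using (hasDerivAt_id (1 : ℝ)).smul_const x
  have hd : HasFDerivAt f (fderiv ℝ f x) ((1 : ℝ) • x) := by
    simpa using (hs.differentiableAt hx).hasFDerivAt
  have h2 := hd.comp_hasDerivAt (1 : ℝ) h1
  have h3 : (f ∘ fun t : ℝ => t • x) =ᶠ[𝓝 1] fun _ => f x := by
    filter_upwards [lt_mem_nhds (zero_lt_one (α := ℝ))] with t ht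
    simp [hf t ht]
  exact h2.unique ((hasDerivAt_const (1 : ℝ) (f x)).congr_of_eventuallyEq h3)

theorem posHomogeneous_radialPow (a : ℤ) : PosHomogeneous a (radialPow a) := by
  intro t ht x
  simp [radialPow, norm_smul, abs_of_pos ht, mul_zpow]

theorem PosHomogeneous.mul {b : ℤ} (hf : PosHomogeneous a f) (hg : PosHomogeneous b g) :
    PosHomogeneous (a + b) (fun y => f y * g y) := by
  intro t ht x
  have htc : (t : ℂ) ≠ 0 := by exact_mod_cast ht.ne'
  simp only [hf t ht, hg t ht, zpow_add₀ htc]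
  ring

theorem smoothAwayFromZero_radialPow (a : ℤ) : SmoothAwayFromZero (radialPow a) := by
  intro x hx
  have hr : ((‖x‖ : ℝ) : ℂ) ≠ 0 := by exact_mod_cast norm_ne_zero_iff.2 hx
  have h1 : ContDiffAt ℝ (⊤ : ℕ∞) (fun y : E3 => ((‖y‖ : ℝ) : ℂ)) x :=
    Complex.ofRealCLM.contDiff.contDiffAt.comp x (contDiffAt_norm ℝ hx)
  cases a with
  | ofNat k => exact (h1.pow k).congr_of_eventuallyEq <| .of_forall fun y => by simp [radialPow]
  | negSucc k =>
    exact ((h1.pow (k + 1)).inv (pow_ne_zero _ hr)).congr_of_eventuallyEq <|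
      .of_forall fun y => by simp [radialPow]

theorem pdC_radialPow (a : ℤ) (hx : x ≠ 0) (i : Fin 3) :
    pdC (radialPow a) i x = a * radialPow (a - 2) x * ((x i : ℝ) : ℂ) := by
  have hr : ‖x‖ ≠ 0 := norm_ne_zero_iff.2 hx
  have hrc : ((‖x‖ : ℝ) : ℂ) ≠ 0 := by exact_mod_cast hr
  have hN := ((contDiffAt_norm ℝ hx (n := 1)).differentiableAt (by simp)).hasFDerivAt
  have hsq := hN.pow 2
  have hnorm : ‖x‖ * fderiv ℝ (fun y : E3 => ‖y‖) x (EuclideanSpace.single i 1) = x i := by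
    have h := congrArg (fun L => L (EuclideanSpace.single i 1))
      (hsq.unique (hasStrictFDerivAt_norm_sq x).hasFDerivAt)
    simp [EuclideanSpace.inner_single_right, mul_assoc] at h
    exact h
  have hcomp := ((hasDerivAt_zpow a (‖x‖ : ℂ) (Or.inl hrc)).comp_ofReal).hasFDerivAt.comp x hN
  have h := hcomp.fderiv
  have hd : pdC (radialPow a) i x = fderiv ℝ (fun y : E3 => ‖y‖) x (EuclideanSpace.single i 1) •
      ((a : ℂ) * (‖x‖ : ℂ) ^ (a - 1)) := by
    have := congrArg (fun L => L (EuclideanSpace.single i 1)) h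
    exact this.trans (by simp)
  rw [hd, ← hnorm, radialPow, show a - 1 = (a - 2) + 1 by ring, zpow_add_one₀ hrc, Complex.real_smul]
  push_cast
  ring

theorem sum_coord_sq (x : E3) : ∑ i : Fin 3, ((x i : ℝ) : ℂ) ^ 2 = (‖x‖ : ℂ) ^ 2 := by
  rw [← Complex.ofReal_pow, EuclideanSpace.real_norm_sq_eq]
  push_cast
  rfl

theorem pdC_coord (i : Fin 3) (x : E3) : pdC (fun y : E3 => ((y i : ℝ) : ℂ)) i x = 1 := by
  have : HasFDerivAt (fun y : E3 => ((y i : ℝ) : ℂ))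
      (Complex.ofRealCLM.comp (EuclideanSpace.proj i : E3 →L[ℝ] ℝ)) x :=
    (Complex.ofRealCLM.comp (EuclideanSpace.proj i : E3 →L[ℝ] ℝ)).hasFDerivAt
  simp [pdC, this.fderiv]

theorem radialPow_eq_mul_norm_sq (a : ℤ) (hx : x ≠ 0) :
    radialPow a x = radialPow (a - 2) x * (‖x‖ : ℂ) ^ 2 := by
  have hrc : ((‖x‖ : ℝ) : ℂ) ≠ 0 := by exact_mod_cast norm_ne_zero_iff.2 hx
  rw [radialPow, radialPow, ← zpow_natCast, ← zpow_add₀ hrc]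
  congr 1
  push_cast
  ring

theorem lapC_radialPow (a : ℤ) (hx : x ≠ 0) :
    lapC (radialPow a) x = a * (a + 1) * radialPow (a - 2) x := by
  have key : ∀ i : Fin 3, pdC (pdC (radialPow a) i) i x =
      a * (a - 2) * radialPow (a - 4) x * ((x i : ℝ) : ℂ) ^ 2 + a * radialPow (a - 2) x := by
    intro i
    have h : pdC (radialPow a) i =ᶠ[𝓝 x]
        fun y => radialPow (a - 2) y * ((a : ℂ) * ((y i : ℝ) : ℂ)) := by
      filter_upwards [eventually_ne_zero hx] with y hy
      rw [pdC_radialPow a hy]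
      ring
    have hc : DifferentiableAt ℝ (fun y : E3 => ((y i : ℝ) : ℂ)) x :=
      (Complex.ofRealCLM.comp (EuclideanSpace.proj i : E3 →L[ℝ] ℝ)).differentiableAt
    have hca := hc.const_mul (a : ℂ)
    rw [(pdC_congr h i).self_of_nhds,
      pdC_mul ((smoothAwayFromZero_radialPow _).differentiableAt hx) hca,
      pdC_mul (differentiableAt_const _) hc, pdC_coord, pdC_radialPow _ hx,
      show a - 2 - 2 = a - 4 by ring]
    simp [pdC]
    ring
  simp only [lapC, key, Finset.sum_add_distrib, ← Finset.mul_sum, sum_coord_sq]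
  rw [radialPow_eq_mul_norm_sq (a - 2) hx, show a - 2 - 2 = a - 4 by ring]
  simp
  ring

/-- `‖x‖ ^ a f` is harmonic away from the origin exactly when the degree `0` function `f` is an
eigenfunction of the spherical Laplacian with eigenvalue `-a (a + 1)`. -/
theorem PosHomogeneous.lapC_radialPow_mul_eq_zero_iff (hf : PosHomogeneous 0 f)
    (hs : SmoothAwayFromZero f) (a : ℤ) (hx : x ≠ 0) :
    lapC (fun y => radialPow a y * f y) x = 0 ↔
      (‖x‖ : ℂ) ^ 2 * lapC f x = -(a * (a + 1)) * f x := by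
  have hrc : ((‖x‖ : ℝ) : ℂ) ≠ 0 := by exact_mod_cast norm_ne_zero_iff.2 hx
  have hcross : ∑ i : Fin 3, _root_.pdC (radialPow a) i x * _root_.pdC f i x = 0 := by
    simp only [pdC_radialPow a hx, mul_assoc, ← Finset.mul_sum,
      hf.sum_coord_mul_pdC_eq_zero hs hx, mul_zero]
  have hne : radialPow (a - 2) x ≠ 0 := zpow_ne_zero _ hrc
  rw [lapC_mul (smoothAwayFromZero_radialPow a) hs hx, hcross, lapC_radialPow a hx,
    radialPow_eq_mul_norm_sq a hx,
    show radialPow (a - 2) x * (‖x‖ : ℂ) ^ 2 * lapC f x + 2 * 0 +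
      a * (a + 1) * radialPow (a - 2) x * f x = radialPow (a - 2) x *
        ((‖x‖ : ℂ) ^ 2 * lapC f x - -(a * (a + 1)) * f x) by ring,
    mul_eq_zero_iff_left hne, sub_eq_zero]

end Homogeneity

section SphereIntegrals

theorem integral_pdC_eq_zero {h : E3 → ℂ} (hd : ContDiff ℝ 1 h) (hc : HasCompactSupport h)
    (i : Fin 3) : ∫ x, pdC h i x = 0 := by
  have hi : Integrable (fun x => fderiv ℝ h x (EuclideanSpace.single i 1)) :=
    ((hd.continuous_fderiv (by simp)).clm_apply continuous_const).integrable_of_hasCompactSupport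
      (hc.fderiv_apply ℝ _)
  have := integral_mul_fderiv_eq_neg_fderiv_mul_of_integrable (μ := (volume : Measure E3))
    (f := fun _ => (1 : ℂ)) (g := h) (v := EuclideanSpace.single i 1) (by simp)
    (by simpa using hi) (by simpa using hd.continuous.integrable_of_hasCompactSupport hc)
    (fun x _ => differentiableAt_const _) (fun x _ => hd.differentiable (by simp) x)
  simpa [pdC] using this

theorem integral_unitize_mul_norm (F : E3 → ℂ) (G : ℝ → ℂ) :
    ∫ x : E3, F (unitize x) * G ‖x‖ =
      (∫ v : Metric.sphere (0 : E3) 1, F v ∂sphereMeasure) *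
        ∫ r : Set.Ioi (0 : ℝ), G r ∂(Measure.volumeIoiPow 2) := by
  calc ∫ x : E3, F (unitize x) * G ‖x‖
      = ∫ x : ({0}ᶜ : Set E3), F (unitize x) * G ‖(x : E3)‖ ∂((volume : Measure E3).comap (↑)) := by
        rw [integral_subtype_comap (measurableSet_singleton _).compl
          fun x : E3 => F (unitize x) * G ‖x‖, restrict_compl_singleton]
    _ = ∫ z, F (z.1 : E3) * G z.2 ∂(volume : Measure E3).toSphere.prod (.volumeIoiPow 2) := by
        have := (volume : Measure E3).measurePreserving_homeomorphUnitSphereProd.integral_comp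
          (Homeomorph.measurableEmbedding _)
          (fun z : Metric.sphere (0 : E3) 1 × Set.Ioi (0 : ℝ) => F (z.1 : E3) * G z.2)
        simpa [unitize] using this
    _ = _ := integral_prod_mul (fun v : Metric.sphere (0 : E3) 1 => F v)
        (fun r : Set.Ioi (0 : ℝ) => G r)

theorem exists_smooth_cutoff : ∃ η : ℝ → ℝ, ContDiff ℝ (⊤ : ℕ∞) η ∧ 0 ≤ η ∧ η 1 ≠ 0 ∧
    (∀ t ≤ 1 / 2, η t = 0) ∧ ∀ t, 2 ≤ t → η t = 0 := by
  let b : ContDiffBump (1 : ℝ) := ⟨1 / 4, 1 / 2, by norm_num, by norm_num⟩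
  refine ⟨b, b.contDiff, fun _ => b.nonneg, ?_, fun t ht => ?_, fun t ht => ?_⟩
  · rw [b.one_of_mem_closedBall (by simp [b])]
    exact one_ne_zero
  · refine b.zero_of_le_dist ?_
    rw [Real.dist_eq, abs_sub_comm]
    exact le_trans (by change (1 / 2 : ℝ) ≤ 1 - t; linarith) (le_abs_self _)
  · refine b.zero_of_le_dist ?_
    rw [Real.dist_eq]
    exact le_trans (by change (1 / 2 : ℝ) ≤ t - 1; linarith) (le_abs_self _)

theorem pdC_comp_norm_sq {χ : ℝ → ℂ} (x : E3) (hχ : DifferentiableAt ℝ χ (‖x‖ ^ 2)) (i : Fin 3) :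
    pdC (fun y => χ (‖y‖ ^ 2)) i x = 2 * deriv χ (‖x‖ ^ 2) * ((x i : ℝ) : ℂ) := by
  have h := hχ.hasDerivAt.hasFDerivAt.comp x (hasStrictFDerivAt_norm_sq x).hasFDerivAt
  have := congrArg (fun L => L (EuclideanSpace.single i 1)) h.fderiv
  refine this.trans ?_
  simp [EuclideanSpace.inner_single_right]
  ring

variable {f g : E3 → ℂ}

/-- The divergence of `φ (g ∇f - f ∇g)` for a radial `φ` and degree `0` homogeneous `f`, `g`. -/
theorem sum_pdC_radial_mul_wronskian (hf : PosHomogeneous 0 f) (hg : PosHomogeneous 0 g)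
    (hfs : SmoothAwayFromZero f) (hgs : SmoothAwayFromZero g) {χ : ℝ → ℂ} {x : E3} (hx : x ≠ 0)
    (hχ : ContDiff ℝ (⊤ : ℕ∞) χ) :
    ∑ i : Fin 3, pdC (fun y => χ (‖y‖ ^ 2) * (g y * pdC f i y - f y * pdC g i y)) i x =
      χ (‖x‖ ^ 2) * (g x * lapC f x - f x * lapC g x) := by
  have hφd : DifferentiableAt ℝ (fun y : E3 => χ (‖y‖ ^ 2)) x :=
    ((hχ.comp (contDiff_norm_sq ℝ)).differentiable (by simp)) x
  have key : ∀ i : Fin 3,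
      pdC (fun y => χ (‖y‖ ^ 2) * (g y * pdC f i y - f y * pdC g i y)) i x =
        χ (‖x‖ ^ 2) * (g x * pdC (pdC f i) i x - f x * pdC (pdC g i) i x) +
          2 * deriv χ (‖x‖ ^ 2) * (g x * (((x i : ℝ) : ℂ) * pdC f i x)
            - f x * (((x i : ℝ) : ℂ) * pdC g i x)) := by
    intro i
    have h1 := (hgs.mul (hfs.pdC i)).differentiableAt hx
    have h2 := (hfs.mul (hgs.pdC i)).differentiableAt hx
    rw [pdC_mul hφd (h1.fun_sub h2), pdC_sub h1 h2,
      pdC_mul (hgs.differentiableAt hx) ((hfs.pdC i).differentiableAt hx),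
      pdC_mul (hfs.differentiableAt hx) ((hgs.pdC i).differentiableAt hx),
      pdC_comp_norm_sq x (hχ.differentiable (by simp) _)]
    ring
  simp only [key, Finset.sum_add_distrib, ← Finset.mul_sum, Finset.sum_sub_distrib,
    hf.sum_coord_mul_pdC_eq_zero hfs hx, hg.sum_coord_mul_pdC_eq_zero hgs hx, lapC]
  ring

theorem PosHomogeneous.apply_unitize (hf : PosHomogeneous 0 f) {x : E3} (hx : x ≠ 0) :
    f (unitize x) = f x := by
  simp [unitize, hf _ (inv_pos.2 (norm_pos_iff.2 hx))]

/-- Eigenfunctions of the spherical Laplacian with distinct eigenvalues are orthogonal. -/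
theorem integral_sphere_mul_eq_zero_of_eigenvalue_ne (hf : PosHomogeneous 0 f)
    (hg : PosHomogeneous 0 g) (hfs : SmoothAwayFromZero f) (hgs : SmoothAwayFromZero g) {a b : ℂ}
    (hfa : ∀ x : E3, x ≠ 0 → (‖x‖ : ℂ) ^ 2 * lapC f x = a * f x)
    (hgb : ∀ x : E3, x ≠ 0 → (‖x‖ : ℂ) ^ 2 * lapC g x = b * g x) (hab : a ≠ b) :
    ∫ v : Metric.sphere (0 : E3) 1, f v * g v ∂sphereMeasure = 0 := by
  obtain ⟨η, hη, hη0, hη1, hηs, hηl⟩ := exists_smooth_cutoff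
  have hηsupp : HasCompactSupport (fun x : E3 => η (‖x‖ ^ 2)) := by
    refine .of_support_subset_isCompact (isCompact_closedBall (0 : E3) 2) fun x hx => ?_
    by_contra hx'
    rw [mem_closedBall_zero_iff, not_le] at hx'
    exact hx (hηl _ (by nlinarith))
  have hηcont : Continuous (fun x : E3 => η (‖x‖ ^ 2)) :=
    hη.continuous.comp (continuous_norm.pow 2)
  have hradial : ∫ r : Set.Ioi (0 : ℝ), (η ((r : ℝ) ^ 2) : ℂ) ∂(Measure.volumeIoiPow 2) ≠ 0 := by
    intro h0
    have h := integral_unitize_mul_norm (fun _ => 1) (fun r => (η (r ^ 2) : ℂ))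
    simp only [h0, mul_zero, one_mul, integral_complex_ofReal, Complex.ofReal_eq_zero] at h
    refine (hηcont.integral_pos_of_hasCompactSupport_nonneg_nonzero (μ := (volume : Measure E3))
      hηsupp (fun x => hη0 _) (x := EuclideanSpace.single 0 1) ?_).ne' h
    simpa using hη1
  let χ : ℝ → ℂ := fun t => ((t * η t : ℝ) : ℂ)
  have hχ : ContDiff ℝ (⊤ : ℕ∞) χ := Complex.ofRealCLM.contDiff.comp (contDiff_id.mul hη)
  let H : Fin 3 → E3 → ℂ := fun i y => χ (‖y‖ ^ 2) * (g y * pdC f i y - f y * pdC g i y)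
  have hHsupp : ∀ i, HasCompactSupport (H i) := by
    refine fun i => hηsupp.mono fun x hx hx' => hx ?_
    have hx'' : η (‖x‖ ^ 2) = 0 := hx'
    simp [H, χ, hx'']
  have hH : ∀ i, ContDiff ℝ 1 (H i) := by
    refine fun i => contDiff_iff_contDiffAt.2 fun x => ?_
    rcases eq_or_ne x 0 with rfl | hx
    · refine (contDiffAt_const (c := (0 : ℂ))).congr_of_eventuallyEq ?_
      have hc : Tendsto (fun y : E3 => ‖y‖ ^ 2) (𝓝 0) (𝓝 0) :=
        (continuous_norm.pow 2).tendsto' (0 : E3) 0 (by simp)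
      filter_upwards [hc.eventually_lt_const (show (0 : ℝ) < 1 / 2 by norm_num)] with y hy
      simp [H, χ, hηs _ hy.le]
    · have h1 : ContDiffAt ℝ (⊤ : ℕ∞) (H i) x :=
        (hχ.comp (contDiff_norm_sq ℝ)).contDiffAt.mul
          (((hgs.mul (hfs.pdC i)) x hx).sub ((hfs.mul (hgs.pdC i)) x hx))
      exact h1.of_le (by exact_mod_cast le_top)
  have hsum : ∫ x : E3, ∑ i, pdC (H i) i x = 0 := by
    rw [integral_finsetSum]
    · simp [integral_pdC_eq_zero (hH _) (hHsupp _)]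
    · exact fun i _ => (((hH i).continuous_fderiv (by simp)).clm_apply
        continuous_const).integrable_of_hasCompactSupport ((hHsupp i).fderiv_apply ℝ _)
  have hpolar := integral_unitize_mul_norm (fun x => f x * g x)
    (fun r => (a - b) * (η (r ^ 2) : ℂ))
  rw [integral_const_mul] at hpolar
  have hae : ∫ x : E3, ∑ i, pdC (H i) i x =
      ∫ x : E3, f (unitize x) * g (unitize x) * ((a - b) * (η (‖x‖ ^ 2) : ℂ)) := by
    refine integral_congr_ae ?_
    filter_upwards [compl_mem_ae_iff.2 (measure_singleton (0 : E3))] with x hx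
    have hx0 : x ≠ 0 := hx
    rw [sum_pdC_radial_mul_wronskian hf hg hfs hgs hx0 hχ, hf.apply_unitize hx0,
      hg.apply_unitize hx0]
    simp only [χ]
    push_cast
    linear_combination (η (‖x‖ ^ 2) : ℂ) * (g x * hfa x hx0 - f x * hgb x hx0)
  rw [← hae, hsum] at hpolar
  have hne := mul_ne_zero (sub_ne_zero.2 hab) hradial
  exact (mul_eq_zero.1 hpolar.symm).resolve_right hne

end SphereIntegrals

theorem posHomogeneous_comp_unitize (F : E3 → ℂ) : PosHomogeneous 0 (fun y => F (unitize y)) := by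
  intro t ht x
  have : unitize (t • x) = unitize x := by
    rw [unitize, unitize, norm_smul, Real.norm_of_nonneg ht.le, smul_smul, mul_inv_rev, mul_assoc,
      inv_mul_cancel₀ ht.ne', mul_one]
  simp [this]

/-- For `n ≥ 1`, `n' ≥ 0` with `n ≠ n'`, the vectorial spherical harmonic
`𝒩ₙᵐ` integrates to zero against the scalar spherical harmonic `Y_{n'}^{m'}`:
`∫_{𝕊²} 𝒩ₙᵐ(x̂) Y_{n'}^{m'}(x̂) ds = 0 ∈ ℂ³` (componentwise). -/
theorem Nvec_integral_against_scalar_harmonic_eq_zero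
    (Y : ℕ → ℤ → E3 → ℂ)
    (hsmooth : ∀ (n : ℕ) (m : ℤ), m ∈ Finset.Icc (-(n : ℤ)) n →
      ContDiffOn ℝ (⊤ : ℕ∞) (fun y : E3 => Y n m (unitize y)) {x : E3 | x ≠ 0})
    (hharm : ∀ (n : ℕ) (m : ℤ), m ∈ Finset.Icc (-(n : ℤ)) n → ∀ x : E3, x ≠ 0 →
      lapC (fun y : E3 => (‖y‖ : ℂ) ^ n * Y n m (unitize y)) x = 0)
    (horth : ∀ (n : ℕ) (m : ℤ) (n' : ℕ) (m' : ℤ), m ∈ Finset.Icc (-(n : ℤ)) n →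
      m' ∈ Finset.Icc (-(n' : ℤ)) n' →
      ∫ v : Metric.sphere (0 : E3) 1,
          Y n m (v : E3) * (starRingEnd ℂ) (Y n' m' (v : E3)) ∂sphereMeasure =
        if n = n' ∧ m = m' then 1 else 0)
    (n n' : ℕ) (hn : 1 ≤ n) (hnn' : n ≠ n')
    (m m' : ℤ) (hm : m ∈ Finset.Icc (-(n : ℤ) + 1) ((n : ℤ) - 1))
    (hm' : m' ∈ Finset.Icc (-(n' : ℤ)) (n' : ℤ)) (i : Fin 3) :
    ∫ v : Metric.sphere (0 : E3) 1,
        Nvec Y n m (v : E3) i * Y n' m' (v : E3) ∂sphereMeasure = 0 := by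
  have hm₁ : m ∈ Finset.Icc (-((n - 1 : ℕ) : ℤ)) ((n - 1 : ℕ) : ℤ) := by
    rw [Finset.mem_Icc] at hm ⊢
    omega
  have hsm : ∀ (k : ℕ) (l : ℤ), l ∈ Finset.Icc (-(k : ℤ)) k →
      SmoothAwayFromZero (fun y => Y k l (unitize y)) := fun k l hl x hx =>
    (hsmooth k l hl).contDiffAt (isOpen_ne.mem_nhds hx)
  have hlap : ∀ (k : ℕ) (l : ℤ), l ∈ Finset.Icc (-(k : ℤ)) k → ∀ x : E3, x ≠ 0 →
      (‖x‖ : ℂ) ^ 2 * lapC (fun y => Y k l (unitize y)) x =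
        -(((k : ℤ) : ℂ) * ((k : ℤ) + 1)) * Y k l (unitize x) := fun k l hl x hx =>
    ((posHomogeneous_comp_unitize (Y k l)).lapC_radialPow_mul_eq_zero_iff (hsm k l hl) k hx).1
      (by simpa [radialPow] using hharm k l hl x hx)
  obtain ⟨k, rfl⟩ : ∃ k, n = k + 1 := ⟨n - 1, by omega⟩
  rw [Nat.add_sub_cancel] at hm₁
  have hu := posHomogeneous_comp_unitize (Y k m)
  have hus := hsm k m hm₁
  set f : E3 → ℂ := fun y => radialPow (k + 2) y *
    pdC (fun y => radialPow (-(k + 1)) y * Y k m (unitize y)) i y with hf_def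
  have hVs : SmoothAwayFromZero (fun y => radialPow (-(k + 1)) y * Y k m (unitize y)) :=
    (smoothAwayFromZero_radialPow _).mul hus
  have hfs : SmoothAwayFromZero f := (smoothAwayFromZero_radialPow _).mul (hVs.pdC i)
  have hf : PosHomogeneous 0 f := by
    have := (posHomogeneous_radialPow (k + 2)).mul
      (((posHomogeneous_radialPow (-(k + 1))).mul hu).pdC i)
    rwa [show (k : ℤ) + 2 + (-(k + 1) + 0 - 1) = 0 by ring] at this
  have hVharm : ∀ x : E3, x ≠ 0 →
      lapC (fun y => radialPow (-(k + 1)) y * Y k m (unitize y)) x = 0 := fun x hx => by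
    rw [hu.lapC_radialPow_mul_eq_zero_iff hus _ hx, hlap k m hm₁ x hx]
    push_cast
    ring
  have hflap : ∀ x : E3, x ≠ 0 →
      (‖x‖ : ℂ) ^ 2 * lapC f x = -(((k : ℂ) + 1) * (k + 2)) * f x := fun x hx => by
    have hW : (fun y => radialPow (-(k + 2)) y * f y) =ᶠ[𝓝 x]
        pdC (fun y => radialPow (-(k + 1)) y * Y k m (unitize y)) i := by
      filter_upwards [eventually_ne_zero hx] with y hy
      rw [hf_def]
      simp only [radialPow]
      rw [← mul_assoc, ← zpow_add₀ (by exact_mod_cast norm_ne_zero_iff.2 hy)]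
      simp
    have h0 : lapC (fun y => radialPow (-(k + 1)) y * Y k m (unitize y)) =ᶠ[𝓝 x] fun _ => 0 := by
      filter_upwards [eventually_ne_zero hx] with y hy using hVharm y hy
    have h := (hf.lapC_radialPow_mul_eq_zero_iff hfs (-(k + 2)) hx).1 <| by
      rw [(lapC_congr hW).self_of_nhds, lapC_pdC hVs hx, (pdC_congr h0 i).self_of_nhds]
      simp [pdC]
    rw [h]
    push_cast
    ring
  have hN : ∀ v : Metric.sphere (0 : E3) 1,
      Nvec Y (k + 1) m v i * Y n' m' v = -(f v * Y n' m' (unitize v)) := fun v => by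
    have hv : ‖(v : E3)‖ = 1 := norm_eq_of_mem_sphere v
    have hv0 : (v : E3) ≠ 0 := ne_zero_of_mem_unit_sphere v
    have huv : unitize (v : E3) = v := by simp [unitize, hv]
    rw [hf_def]
    beta_reduce
    rw [pdC_mul ((smoothAwayFromZero_radialPow _).differentiableAt hv0)
      (hus.differentiableAt hv0), pdC_radialPow _ hv0]
    simp only [radialPow, hv, huv, Nvec, Nat.add_sub_cancel]
    simp [surfGrad, pdC]
    ring
  simp only [hN, integral_neg, neg_eq_zero]
  refine integral_sphere_mul_eq_zero_of_eigenvalue_ne (g := fun y => Y n' m' (unitize y))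
    hf (posHomogeneous_comp_unitize _) hfs (hsm n' m' hm') hflap (hlap n' m' hm') fun h => hnn' ?_
  have h' : (k + 1) * (k + 2) = n' * (n' + 1) := by exact_mod_cast neg_injective h
  rcases lt_trichotomy (k + 1) n' with hlt | heq | hgt
  · nlinarith
  · exact heq
  · nlinarith
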